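/- Let u, v be consistently oriented unit spacelike vectors in ℝ³, let p, w ∈ ℝ³, and suppose the crooked planes C(u,p) and C(v,p+w) are disjoint. Then C(v,p+w) ⊂ H(−u,p). -/

import Mathlib

open Matrix

noncomputable section

/-- Minkowski space: ℝ³. -/
abbrev V3 : Type := Fin 3 → ℝ

/-- The Lorentzian inner product `x·y = x₁y₁ + x₂y₂ − x₃y₃`. -/
def mdot (x y : V3) : ℝ := x 0 * y 0 + x 1 * y 1 - x 2 * y 2

/-- The Lorentzian cross product: the unique bilinear map with
`mdot u (lcross v w) = det [u v w]` (columns `u`, `v`, `w`). -/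
def lcross (v w : V3) : V3 :=
  ![v 1 * w 2 - v 2 * w 1, v 2 * w 0 - v 0 * w 2, -(v 0 * w 1 - v 1 * w 0)]

/-- For a spacelike vector `v`, the future-pointing null vector `v⁺` of Euclidean
length 1 which is Lorentz-orthogonal to `v`, where `v⁻, v⁺` are ordered so that
`det[v⁻ v⁺ v] > 0`. -/
def nullPlus (v : V3) : V3 :=
  (1 / (Real.sqrt 2 * (v 0 ^ 2 + v 1 ^ 2))) •
    ![v 0 * v 2 + v 1 * Real.sqrt (mdot v v),
      v 1 * v 2 - v 0 * Real.sqrt (mdot v v),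
      v 0 ^ 2 + v 1 ^ 2]

/-- For a spacelike vector `v`, the future-pointing null vector `v⁻` of Euclidean
length 1 which is Lorentz-orthogonal to `v`, where `v⁻, v⁺` are ordered so that
`det[v⁻ v⁺ v] > 0`. -/
def nullMinus (v : V3) : V3 :=
  (1 / (Real.sqrt 2 * (v 0 ^ 2 + v 1 ^ 2))) •
    ![v 0 * v 2 - v 1 * Real.sqrt (mdot v v),
      v 1 * v 2 + v 0 * Real.sqrt (mdot v v),
      v 0 ^ 2 + v 1 ^ 2]

/-- `P(x)`: for a future-pointing null vector `x`, the set of spacelike vectors `w`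
with `w·x = 0` such that `(w/√(w·w))⁺` is a positive scalar multiple of `x`. -/
def wingSet (x : V3) : Set V3 :=
  {w | 0 < mdot w w ∧ mdot w x = 0 ∧
    ∃ t : ℝ, 0 < t ∧ nullPlus ((Real.sqrt (mdot w w))⁻¹ • w) = t • x}

/-- The crooked plane `C(v,p)`: union of the stem `p + {x | x·v = 0, x·x ≤ 0}`
and the wings `p + P(v⁺)` and `p + P(v⁻)`. -/
def crookedPlane (v p : V3) : Set V3 :=
  {q | mdot (q - p) v = 0 ∧ mdot (q - p) (q - p) ≤ 0} ∪
  {q | q - p ∈ wingSet (nullPlus v)} ∪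
  {q | q - p ∈ wingSet (nullMinus v)}

/-- The crooked half-space `H(v,p)`. -/
def crookedHalf (v p : V3) : Set V3 :=
  {q | (0 ≤ mdot (q - p) v → mdot (q - p) (nullPlus v) ≤ 0) ∧
       (mdot (q - p) v ≤ 0 → 0 ≤ mdot (q - p) (nullMinus v))}

/-- Spacelike vectors `u`, `v` are consistently oriented. -/
def consistentlyOriented (u v : V3) : Prop :=
  mdot u v < 0 ∧ mdot u (nullPlus v) ≤ 0 ∧ mdot u (nullMinus v) ≤ 0 ∧
  mdot v (nullPlus u) ≤ 0 ∧ mdot v (nullMinus u) ≤ 0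

/-- `g` is a linear isometry of the Lorentzian inner product. -/
def isLorentz (g : Matrix (Fin 3) (Fin 3) ℝ) : Prop :=
  ∀ x y : V3, mdot (g.mulVec x) (g.mulVec y) = mdot x y

/-- Membership in `SO(2,1)⁰`, the identity component of the group of linear
isometries of `mdot`: Lorentzian, determinant one, and orthochronous. -/
def inSO21p (g : Matrix (Fin 3) (Fin 3) ℝ) : Prop :=
  isLorentz g ∧ g.det = 1 ∧ 0 < g.mulVec ![0, 0, 1] 2

/-- `g` is hyperbolic: it has three distinct real eigenvalues. -/
def isHyperbolic (g : Matrix (Fin 3) (Fin 3) ℝ) : Prop :=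
  ∃ a b c : ℝ, a ≠ b ∧ a ≠ c ∧ b ≠ c ∧
    g.charpoly = (Polynomial.X - Polynomial.C a) * (Polynomial.X - Polynomial.C b) *
      (Polynomial.X - Polynomial.C c)

/-- `g ≠ I` is parabolic: `1` is its only eigenvalue. -/
def isParabolic (g : Matrix (Fin 3) (Fin 3) ℝ) : Prop :=
  g ≠ 1 ∧ g.charpoly = (Polynomial.X - Polynomial.C 1) ^ 3

/-- `v` is a positive fixed vector of `g`: `gv = v`, `v ≠ 0`, and
`det[v x gx] > 0` for some null or timelike `x` which is not an eigenvector. -/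
def positiveFixed (g : Matrix (Fin 3) (Fin 3) ℝ) (v : V3) : Prop :=
  v ≠ 0 ∧ g.mulVec v = v ∧
  ∃ x : V3, mdot x x ≤ 0 ∧ (∀ t : ℝ, g.mulVec x ≠ t • x) ∧
    0 < mdot v (lcross x (g.mulVec x))

/-- A subgroup of homeomorphisms (here: permutations) of ℝ³ acts properly
discontinuously: for every compact `K`, only finitely many elements move `K`
to meet `K`. -/
def properlyDisc (Γ : Subgroup (Equiv.Perm V3)) : Prop :=
  ∀ K : Set V3, IsCompact K →
    {f : Equiv.Perm V3 | f ∈ Γ ∧ ((f : V3 → V3) '' K ∩ K).Nonempty}.Finite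

/-- The action of `Γ` on ℝ³ is free: no nonidentity element has a fixed point. -/
def freeAction (Γ : Subgroup (Equiv.Perm V3)) : Prop :=
  ∀ f ∈ Γ, f ≠ 1 → ∀ x : V3, f x ≠ x

section Bilinear

variable (x y z : V3) (t : ℝ)

lemma mdot_comm : mdot x y = mdot y x := by
  simp only [mdot]; ring

lemma mdot_add_left : mdot (x + y) z = mdot x z + mdot y z := by
  simp only [mdot, Pi.add_apply]; ring

lemma mdot_smul_left : mdot (t • x) y = t * mdot x y := by
  simp only [mdot, Pi.smul_apply, smul_eq_mul]; ring

lemma mdot_smul_right : mdot x (t • y) = t * mdot x y := by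
  simp only [mdot, Pi.smul_apply, smul_eq_mul]; ring

lemma mdot_neg_right : mdot x (-y) = -mdot x y := by
  simp only [mdot, Pi.neg_apply]; ring

lemma mdot_neg_neg : mdot (-x) (-y) = mdot x y := by
  simp only [mdot, Pi.neg_apply]; ring

end Bilinear

lemma continuous_mdot_sub (p x : V3) : Continuous fun q : V3 => mdot (q - p) x := by
  unfold mdot
  fun_prop

lemma nullMinus_eq_nullPlus_neg (v : V3) : nullMinus v = nullPlus (-v) := by
  simp [nullMinus, nullPlus, mdot_neg_neg, sub_eq_add_neg]

/-- A unit spacelike vector and its `nullPlus`, in terms of the direction `(c, s)` of the latter. -/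
lemma exists_nullPlus_direction {v : V3} (hv : mdot v v = 1) :
    ∃ c s : ℝ, c ^ 2 + s ^ 2 = 1 ∧ v 0 = v 2 * c - s ∧ v 1 = v 2 * s + c ∧
      nullPlus v = (1 / Real.sqrt 2) • ![c, s, 1] := by
  have hD : v 0 ^ 2 + v 1 ^ 2 = 1 + v 2 ^ 2 := by
    simp only [mdot] at hv; linarith
  have hpos : 0 < v 0 ^ 2 + v 1 ^ 2 := by rw [hD]; positivity
  have hne := hpos.ne'
  have h2 : v 2 ^ 2 = v 0 ^ 2 + v 1 ^ 2 - 1 := by linarith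
  refine ⟨(v 0 * v 2 + v 1) / (v 0 ^ 2 + v 1 ^ 2), (v 1 * v 2 - v 0) / (v 0 ^ 2 + v 1 ^ 2),
    ?_, ?_, ?_, ?_⟩
  · field_simp
    linear_combination (v 0 ^ 2 + v 1 ^ 2) * h2
  · field_simp
    linear_combination -v 0 * h2
  · field_simp
    linear_combination -v 1 * h2
  · have h2 : Real.sqrt 2 ≠ 0 := by positivity
    ext i
    fin_cases i <;> simp [nullPlus, hv] <;> field_simp

lemma nullPlus_of_direction {c s z : ℝ} (h : c ^ 2 + s ^ 2 = 1) :
    nullPlus ![z * c - s, z * s + c, z] = (1 / Real.sqrt 2) • ![c, s, 1] := by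
  have hn : mdot ![z * c - s, z * s + c, z] ![z * c - s, z * s + c, z] = 1 := by
    simp [mdot]; linear_combination (z ^ 2 + 1) * h
  have hD : (z * c - s) ^ 2 + (z * s + c) ^ 2 = 1 + z ^ 2 := by
    linear_combination (z ^ 2 + 1) * h
  have hpos : 1 + z ^ 2 ≠ 0 := by positivity
  have h2 : Real.sqrt 2 ≠ 0 := by positivity
  ext i
  fin_cases i <;> simp [nullPlus, hn, hD] <;> field_simp <;> ring

lemma mdot_nullPlus_self {v : V3} (hv : mdot v v = 1) : mdot v (nullPlus v) = 0 := by
  obtain ⟨c, s, h, h0, h1, hn⟩ := exists_nullPlus_direction hv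
  rw [hn, mdot_smul_right]
  simp only [mdot, h0, h1]
  simp
  linear_combination v 2 * h

lemma mdot_nullPlus_nullPlus {v : V3} (hv : mdot v v = 1) :
    mdot (nullPlus v) (nullPlus v) = 0 := by
  obtain ⟨c, s, h, -, -, hn⟩ := exists_nullPlus_direction hv
  rw [hn, mdot_smul_right, mdot_smul_left]
  simp [mdot]
  linear_combination h

lemma mdot_nullPlus_nonpos {u v : V3} (hu : mdot u u = 1) (hv : mdot v v = 1) :
    mdot (nullPlus u) (nullPlus v) ≤ 0 ∧
      (mdot (nullPlus u) (nullPlus v) = 0 → nullPlus u = nullPlus v) := by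
  obtain ⟨c, s, h, -, -, hn⟩ := exists_nullPlus_direction hu
  obtain ⟨c', s', h', -, -, hn'⟩ := exists_nullPlus_direction hv
  have key : mdot (nullPlus u) (nullPlus v) = -((c - c') ^ 2 + (s - s') ^ 2) / 4 := by
    rw [hn, hn', mdot_smul_right, mdot_smul_left, ← mul_assoc]
    have : 1 / Real.sqrt 2 * (1 / Real.sqrt 2) = 1 / 2 := by
      rw [div_mul_div_comm, Real.mul_self_sqrt (by norm_num)]; norm_num
    rw [this]
    simp [mdot]
    linear_combination (h + h') / 4
  rw [key]
  refine ⟨by nlinarith [sq_nonneg (c - c'), sq_nonneg (s - s')], fun h0 => ?_⟩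
  have hc : c - c' = 0 := by nlinarith [sq_nonneg (c - c'), sq_nonneg (s - s')]
  have hs : s - s' = 0 := by nlinarith [sq_nonneg (c - c'), sq_nonneg (s - s')]
  rw [hn, hn', sub_eq_zero.1 hc, sub_eq_zero.1 hs]

/-- The Lorentzian norm in the basis `u`, `u⁺`, `u⁻`. -/
lemma mdot_self_eq {u : V3} (hu : mdot u u = 1) (x : V3) :
    mdot x x = mdot x u ^ 2 -
      2 * (1 + u 2 ^ 2) * mdot x (nullPlus u) * mdot x (nullPlus (-u)) := by
  have hD : u 0 ^ 2 + u 1 ^ 2 = 1 + u 2 ^ 2 := by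
    simp only [mdot] at hu; linarith
  have hpos : 1 + u 2 ^ 2 ≠ 0 := by positivity
  have hs2 : Real.sqrt 2 ^ 2 = 2 := Real.sq_sqrt (by norm_num)
  have hs : Real.sqrt 2 ≠ 0 := by positivity
  have hplus : mdot x (nullPlus u) = (x 0 * (u 0 * u 2 + u 1) + x 1 * (u 1 * u 2 - u 0)
      - x 2 * (1 + u 2 ^ 2)) / (Real.sqrt 2 * (1 + u 2 ^ 2)) := by
    simp [mdot, nullPlus, hD]
    rw [show u 0 * u 0 + u 1 * u 1 - u 2 * u 2 = 1 by linarith]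
    field_simp
    simp
  have hminus : mdot x (nullPlus (-u)) = (x 0 * (u 0 * u 2 - u 1) + x 1 * (u 1 * u 2 + u 0)
      - x 2 * (1 + u 2 ^ 2)) / (Real.sqrt 2 * (1 + u 2 ^ 2)) := by
    simp [mdot, nullPlus, hD]
    rw [show u 0 * u 0 + u 1 * u 1 - u 2 * u 2 = 1 by linarith]
    field_simp
    simp
    ring_nf
    simp
  rw [hplus, hminus]
  field_simp
  rw [hs2]
  simp only [mdot]
  linear_combination -2 * (x 0 ^ 2 + x 1 ^ 2) * hD

lemma mdot_nullPlus_nullPlus_neg {u : V3} (hu : mdot u u = 1) :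
    mdot (nullPlus u) (nullPlus (-u)) < 0 := by
  have hnu : mdot (-u) (-u) = 1 := by rwa [mdot_neg_neg]
  obtain ⟨hle, heq⟩ := mdot_nullPlus_nonpos hu hnu
  refine lt_of_le_of_ne hle fun h0 => ?_
  obtain ⟨c, s, h, h0', h1', hn⟩ := exists_nullPlus_direction hu
  obtain ⟨c', s', h', h0'', h1'', hn'⟩ := exists_nullPlus_direction hnu
  have e := heq h0
  rw [hn, hn'] at e
  have hs : Real.sqrt 2 ≠ 0 := by positivity
  have e0 := congrFun e 0
  have e1 := congrFun e 1
  simp at e0 e1 h0'' h1''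
  subst e0 e1
  nlinarith

lemma mem_wingSet_nullPlus {v x : V3} (hv : mdot v v = 1) (h0 : mdot x (nullPlus v) = 0)
    (hpos : 0 < mdot x v) : x ∈ wingSet (nullPlus v) := by
  have hxx : mdot x x = mdot x v ^ 2 := by rw [mdot_self_eq hv, h0]; ring
  refine ⟨by rw [hxx]; positivity, h0, 1, one_pos, ?_⟩
  rw [one_smul, hxx, Real.sqrt_sq hpos.le]
  obtain ⟨c, s, h, hv0, hv1, hn⟩ := exists_nullPlus_direction hv
  have hs : Real.sqrt 2 ≠ 0 := by positivity
  have hx2 : x 2 = c * x 0 + s * x 1 := by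
    rw [hn, mdot_smul_right] at h0
    simp [mdot] at h0
    linarith
  have hm : mdot x v = c * x 1 - s * x 0 := by
    simp only [mdot, hv0, hv1, hx2]; ring
  have key : (mdot x v)⁻¹ • x = ![((mdot x v)⁻¹ * x 2) * c - s, ((mdot x v)⁻¹ * x 2) * s + c,
      (mdot x v)⁻¹ * x 2] := by
    have hne := hpos.ne'
    ext i
    fin_cases i
    · simp
      field_simp
      rw [hm, hx2]
      linear_combination -x 0 * h
    · simp
      field_simp
      rw [hm, hx2]
      linear_combination -x 1 * h
    · simp
  rw [key, hn, nullPlus_of_direction h]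

lemma smul_mem_wingSet {x y : V3} (hy : y ∈ wingSet x) {t : ℝ} (ht : 0 < t) :
    t • y ∈ wingSet x := by
  obtain ⟨h1, h2, a, ha, h3⟩ := hy
  have e : mdot (t • y) (t • y) = t ^ 2 * mdot y y := by
    rw [mdot_smul_left, mdot_smul_right]; ring
  refine ⟨by rw [e]; positivity, by rw [mdot_smul_left, h2, mul_zero], a, ha, ?_⟩
  rw [e, Real.sqrt_mul (sq_nonneg t), Real.sqrt_sq ht.le, smul_smul, mul_inv, mul_assoc,
    mul_comm _ t, inv_mul_cancel_left₀ ht.ne', h3]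

lemma crookedPlane_neg (v p : V3) : crookedPlane (-v) p = crookedPlane v p := by
  ext q
  simp only [crookedPlane, nullMinus_eq_nullPlus_neg, neg_neg, mdot_neg_right, neg_eq_zero,
    Set.mem_union, Set.mem_ofPred_eq]
  tauto

lemma center_mem_crookedPlane (v p : V3) : p ∈ crookedPlane v p :=
  Or.inl (Or.inl (by simp [mdot]))

lemma starConvex_crookedPlane (v p : V3) : StarConvex ℝ p (crookedPlane v p) := by
  rw [starConvex_iff_forall_pos (center_mem_crookedPlane v p)]
  intro q hq a b ha hb hab
  have e : a • p + b • q - p = b • (q - p) := by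
    rw [eq_sub_of_add_eq hab]; module
  rcases hq with (⟨h1, h2⟩ | h) | h
  · refine Or.inl (Or.inl ⟨?_, ?_⟩)
    · rw [e, mdot_smul_left, h1, mul_zero]
    · rw [e, mdot_smul_left, mdot_smul_right, ← mul_assoc]
      exact mul_nonpos_of_nonneg_of_nonpos (by positivity) h2
  · refine Or.inl (Or.inr ?_)
    rw [Set.mem_ofPred_eq, e]
    exact smul_mem_wingSet h hb
  · refine Or.inr ?_
    rw [Set.mem_ofPred_eq, e]
    exact smul_mem_wingSet h hb

/-- The open crooked half-space, a connected component of the complement of `C(u,p)`. -/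
def openCrookedHalf (u p : V3) : Set V3 :=
  {q | (0 ≤ mdot (q - p) u → mdot (q - p) (nullPlus u) < 0) ∧
       (mdot (q - p) u ≤ 0 → 0 < mdot (q - p) (nullPlus (-u)))}

lemma openCrookedHalf_subset (u p : V3) : openCrookedHalf u p ⊆ crookedHalf u p := by
  rintro q ⟨h1, h2⟩
  refine ⟨fun h => (h1 h).le, fun h => ?_⟩
  rw [nullMinus_eq_nullPlus_neg]
  exact (h2 h).le

lemma isOpen_openCrookedHalf (u p : V3) : IsOpen (openCrookedHalf u p) := by
  have e : openCrookedHalf u p =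
      ({q | mdot (q - p) u < 0} ∪ {q | mdot (q - p) (nullPlus u) < 0}) ∩
      ({q | 0 < mdot (q - p) u} ∪ {q | 0 < mdot (q - p) (nullPlus (-u))}) := by
    ext q
    simp only [openCrookedHalf, Set.mem_inter_iff, Set.mem_union, Set.mem_ofPred_eq,
      imp_iff_not_or, not_le]
  rw [e]
  have hc := continuous_mdot_sub p
  exact ((isOpen_lt (hc _) continuous_const).union (isOpen_lt (hc _) continuous_const)).inter
    ((isOpen_lt continuous_const (hc _)).union (isOpen_lt continuous_const (hc _)))

lemma disjoint_openCrookedHalf_neg (u p : V3) :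
    Disjoint (openCrookedHalf u p) (openCrookedHalf (-u) p) := by
  rw [Set.disjoint_left]
  rintro q ⟨h1, h2⟩ ⟨h3, h4⟩
  rw [mdot_neg_right] at h3 h4
  rw [neg_neg] at h4
  rcases le_total 0 (mdot (q - p) u) with h | h
  · exact lt_asymm (h1 h) (h4 (by linarith))
  · exact lt_asymm (h2 h) (h3 (by linarith))

lemma compl_crookedPlane_subset {u : V3} (hu : mdot u u = 1) (p : V3) :
    (crookedPlane u p)ᶜ ⊆ openCrookedHalf u p ∪ openCrookedHalf (-u) p := by
  intro q hq
  have hnu : mdot (-u) (-u) = 1 := by rwa [mdot_neg_neg]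
  simp only [crookedPlane, nullMinus_eq_nullPlus_neg, Set.mem_compl_iff, Set.mem_union,
    Set.mem_ofPred_eq, not_or] at hq
  obtain ⟨⟨hstem, hplus⟩, hminus⟩ := hq
  simp only [openCrookedHalf, Set.mem_union, Set.mem_ofPred_eq, mdot_neg_right, neg_neg]
  set x := q - p
  rcases lt_trichotomy (mdot x u) 0 with h | h | h
  · have hne : mdot x (nullPlus (-u)) ≠ 0 := fun h0 =>
      hminus (mem_wingSet_nullPlus hnu h0 (by rw [mdot_neg_right]; linarith))
    rcases lt_or_gt_of_ne hne with h' | h'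
    · exact Or.inr ⟨fun _ => h', fun h'' => by linarith⟩
    · exact Or.inl ⟨fun h'' => by linarith, fun _ => h'⟩
  · have hxx : 0 < -(mdot x (nullPlus u) * mdot x (nullPlus (-u))) := by
      have hpos : 0 < mdot x x := not_le.1 fun h' => hstem ⟨h, h'⟩
      rw [mdot_self_eq hu, h] at hpos
      refine pos_of_mul_pos_right (a := 2 * (1 + u 2 ^ 2)) ?_ (by positivity)
      linarith
    rcases mul_neg_iff.1 (neg_pos.1 hxx) with ⟨h1, h2⟩ | ⟨h1, h2⟩
    · exact Or.inr ⟨fun _ => h2, fun _ => h1⟩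
    · exact Or.inl ⟨fun _ => h1, fun _ => h2⟩
  · have hne : mdot x (nullPlus u) ≠ 0 := fun h0 => hplus (mem_wingSet_nullPlus hu h0 h)
    rcases lt_or_gt_of_ne hne with h' | h'
    · exact Or.inl ⟨fun _ => h', fun h'' => by linarith⟩
    · exact Or.inr ⟨fun h'' => by linarith, fun _ => h'⟩

lemma exists_pos_add_mul_nonpos (r : ℝ) {a : ℝ} (ha : a < 0) : ∃ t, 0 < t ∧ r + t * a ≤ 0 := by
  refine ⟨(|r| + 1) / (-a), div_pos (by positivity) (by linarith), ?_⟩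
  have e : (|r| + 1) / (-a) * a = -(|r| + 1) := by
    field_simp [ha.ne]
  rw [e]
  linarith [le_abs_self r]

lemma wing_mem_crookedPlane {v : V3} (hv : mdot v v = 1) (p : V3) {a : ℝ} (ha : 0 < a) (b : ℝ) :
    p + (a • v + b • nullPlus v) ∈ crookedPlane v p := by
  refine Or.inl (Or.inr ?_)
  rw [Set.mem_ofPred_eq, add_sub_cancel_left]
  refine mem_wingSet_nullPlus hv ?_ ?_
  · rw [mdot_add_left, mdot_smul_left, mdot_smul_left, mdot_nullPlus_self hv,
      mdot_nullPlus_nullPlus hv]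
    ring
  · rw [mdot_add_left, mdot_smul_left, mdot_smul_left, mdot_comm (nullPlus v),
      mdot_nullPlus_self hv, hv]
    linarith

lemma ray_mem_crookedPlane {v : V3} (hv : mdot v v = 1) (p : V3) (b : ℝ) :
    p + b • nullPlus v ∈ crookedPlane v p := by
  refine Or.inl (Or.inl ?_)
  rw [Set.mem_ofPred_eq, add_sub_cancel_left]
  refine ⟨?_, ?_⟩
  · rw [mdot_smul_left, mdot_comm, mdot_nullPlus_self hv, mul_zero]
  · rw [mdot_smul_left, mdot_smul_right, mdot_nullPlus_nullPlus hv]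
    simp

lemma not_crookedPlane_subset_openCrookedHalf {u v : V3} (hu : mdot u u = 1) (hv : mdot v v = 1)
    (hco : consistentlyOriented u v) (p w : V3) :
    ¬ crookedPlane v (p + w) ⊆ openCrookedHalf u p := by
  intro hsub
  obtain ⟨huv, hup, hum, hvp, hvm⟩ := hco
  rw [nullMinus_eq_nullPlus_neg] at hum hvm
  have hnu : mdot (-u) (-u) = 1 := by rwa [mdot_neg_neg]
  have hnv : mdot (-v) (-v) = 1 := by rwa [mdot_neg_neg]
  have hshift (y : V3) : p + w + y - p = w + y := by abel
  rw [mdot_comm] at huv hup hum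
  obtain ⟨hle, heq⟩ := mdot_nullPlus_nonpos hv hnu
  obtain ⟨hle', heq'⟩ := mdot_nullPlus_nonpos hnv hu
  rcases hle.lt_or_eq with hlt | h0
  · obtain ⟨a, ha, ha'⟩ := exists_pos_add_mul_nonpos (mdot w u) huv
    obtain ⟨b, hb, hb'⟩ := exists_pos_add_mul_nonpos (mdot w (nullPlus (-u))) hlt
    have h := (hsub (wing_mem_crookedPlane hv (p + w) ha b)).2
    rw [hshift] at h
    simp only [mdot_add_left, mdot_smul_left] at h
    have := h (by nlinarith)
    nlinarith
  rcases hle'.lt_or_eq with hlt | h0'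
  · obtain ⟨a, ha, ha'⟩ := exists_pos_add_mul_nonpos (-mdot w u) huv
    obtain ⟨b, hb, hb'⟩ := exists_pos_add_mul_nonpos (-mdot w (nullPlus u)) hlt
    have hmem := wing_mem_crookedPlane hnv (p + w) ha (-b)
    rw [crookedPlane_neg] at hmem
    have h := (hsub hmem).1
    rw [hshift, smul_neg, ← neg_smul] at h
    simp only [mdot_add_left, mdot_smul_left] at h
    have := h (by nlinarith)
    nlinarith
  have hk := mdot_nullPlus_nullPlus_neg hu
  have hperp : mdot (nullPlus u) u = 0 := by rw [mdot_comm, mdot_nullPlus_self hu]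
  have hperp' : mdot (nullPlus (-u)) u = 0 := by
    have := mdot_nullPlus_self hnu
    rwa [mdot_comm, mdot_neg_right, neg_eq_zero] at this
  rcases le_total (mdot w u) 0 with hw | hw
  · obtain ⟨b, hb, hb'⟩ := exists_pos_add_mul_nonpos (mdot w (nullPlus (-u))) hk
    have hmem := ray_mem_crookedPlane hnv (p + w) b
    rw [crookedPlane_neg, heq' h0'] at hmem
    have h := (hsub hmem).2
    rw [hshift] at h
    simp only [mdot_add_left, mdot_smul_left, hperp] at h
    linarith [h (by linarith)]
  · obtain ⟨b, hb, hb'⟩ := exists_pos_add_mul_nonpos (-mdot w (nullPlus u)) hk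
    have hmem := ray_mem_crookedPlane hv (p + w) (-b)
    rw [heq h0] at hmem
    have h := (hsub hmem).1
    rw [hshift] at h
    simp only [mdot_add_left, mdot_smul_left, hperp', mdot_comm (nullPlus (-u)) (nullPlus u)] at h
    linarith [h (by linarith)]

/-- If `u`, `v` are consistently oriented unit spacelike vectors and
the crooked planes `C(u,p)` and `C(v,p+w)` are disjoint, then
`C(v,p+w) ⊂ H(−u,p)`. -/
theorem disjoint_crooked_plane_in_halfspace
    (u v p w : V3)
    (hu : mdot u u = 1) (hv : mdot v v = 1)
    (hco : consistentlyOriented u v)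
    (hdisj : crookedPlane u p ∩ crookedPlane v (p + w) = ∅) :
    crookedPlane v (p + w) ⊆ crookedHalf (-u) p := by
  have hcover : crookedPlane v (p + w) ⊆ openCrookedHalf u p ∪ openCrookedHalf (-u) p :=
    fun q hq => compl_crookedPlane_subset hu p fun hq' =>
      Set.notMem_empty q (hdisj ▸ ⟨hq', hq⟩)
  have hconn : IsPreconnected (crookedPlane v (p + w)) :=
    ((starConvex_crookedPlane v (p + w)).isPathConnected
      (center_mem_crookedPlane v (p + w))).isConnected.isPreconnected
  rcases IsPreconnected.subset_or_subset (isOpen_openCrookedHalf u p)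
    (isOpen_openCrookedHalf (-u) p) (disjoint_openCrookedHalf_neg u p) hcover hconn with h | h
  · exact absurd h (not_crookedPlane_subset_openCrookedHalf hu hv hco p w)
  · exact h.trans (openCrookedHalf_subset (-u) p)
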